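/- Let 0 < p < q ≤ ∞ with q < ∞, let N be a positive integer, let X ∈ M_N, and let s be a positive integer with s ≤ N. Then ρ_s(X)_{S_q} ≤ D_{p,q} · s^{−(1/p − 1/q)} · ‖X‖_{S_{p,∞}}, where D_{p,q} = (q/p − 1)^{−1/q}. -/

import Mathlib

noncomputable def singVals {N : ℕ} (X : Matrix (Fin N) (Fin N) ℝ) : Fin N → ℝ :=
  fun i => Real.sqrt ((Matrix.isHermitian_conjTranspose_mul_self X).eigenvalues i)

/-- The Schatten `p`-quasi-norm of a real `N × N` matrix. -/
noncomputable def schattenNorm {N : ℕ} (p : ℝ) (X : Matrix (Fin N) (Fin N) ℝ) : ℝ :=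
  (∑ i, singVals X i ^ p) ^ (1 / p)

/-- The singular values of `X` arranged in nonincreasing order:
`sortedSingVals X k` is the `(k+1)`-st largest singular value of `X`. -/
noncomputable def sortedSingVals {N : ℕ} (X : Matrix (Fin N) (Fin N) ℝ) : Fin N → ℝ :=
  fun k => (singVals X ∘ Tuple.sort (singVals X)) k.rev

/-- The weak Schatten `p`-quasi-norm: `max_{1 ≤ k ≤ N} k^{1/p} σ*_k(X)`. -/
noncomputable def weakSchattenNorm {N : ℕ} (p : ℝ) (X : Matrix (Fin N) (Fin N) ℝ) : ℝ :=
  ⨆ k : Fin N, ((k : ℝ) + 1) ^ (1 / p) * sortedSingVals X k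

/-- Best rank-`s` approximation error in the Schatten `q`-quasi-norm. -/
noncomputable def rhoS {N : ℕ} (q : ℝ) (s : ℕ) (X : Matrix (Fin N) (Fin N) ℝ) : ℝ :=
  sInf ((fun Y => schattenNorm q (X - Y)) '' {Y | Y.rank ≤ s})

open Matrix Finset

/-- A discrete comparison with the derivative of `x ^ (1 - r)`. -/
lemma mul_rpow_neg_le_sub_rpow {r x : ℝ} (hr : 1 < r) (hx : 0 < x) :
    (r - 1) * (x + 1) ^ (-r) ≤ x ^ (1 - r) - (x + 1) ^ (1 - r) := by
  have hx1 : 0 < x + 1 := by linarith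
  have hquot : 0 < x / (x + 1) := by positivity
  have hlog : Real.log (x / (x + 1)) ≤ -(1 / (x + 1)) := by
    refine (Real.log_le_sub_one_of_pos hquot).trans (le_of_eq ?_)
    field_simp
    ring
  have hbern : 1 + (r - 1) * (1 / (x + 1)) ≤ (x / (x + 1)) ^ (1 - r) := by
    rw [Real.rpow_def_of_pos hquot]
    have hexp := Real.add_one_le_exp (Real.log (x / (x + 1)) * (1 - r))
    nlinarith
  have hfac : x ^ (1 - r) = (x + 1) ^ (1 - r) * (x / (x + 1)) ^ (1 - r) := by
    rw [← Real.mul_rpow hx1.le hquot.le]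
    congr 1
    field_simp
  have hneg : (x + 1) ^ (-r) = (x + 1) ^ (1 - r) * (1 / (x + 1)) := by
    rw [show -r = (1 - r) - 1 by ring, Real.rpow_sub_one hx1.ne']
    ring
  have hpos : 0 < (x + 1) ^ (1 - r) := Real.rpow_pos_of_pos hx1 _
  rw [hfac, hneg]
  nlinarith [mul_le_mul_of_nonneg_left hbern hpos.le]

/-- The tail of the `r`-series starting after `s` is at most `s ^ (1 - r) / (r - 1)`. -/
lemma sum_tail_rpow_neg_le {r : ℝ} (hr : 1 < r) {s N : ℕ} (hs : 0 < s) (hsN : s ≤ N) :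
    ∑ k : Fin N, (if (k : ℕ) < s then 0 else ((k : ℝ) + 1) ^ (-r)) ≤
      (s : ℝ) ^ (1 - r) / (r - 1) := by
  rw [Fin.sum_univ_eq_sum_range (fun k : ℕ => if k < s then (0 : ℝ) else ((k : ℝ) + 1) ^ (-r)) N,
    le_div_iff₀ (by linarith)]
  suffices h : (∑ k ∈ range N, if k < s then (0 : ℝ) else ((k : ℝ) + 1) ^ (-r)) * (r - 1) ≤
      (s : ℝ) ^ (1 - r) - (N : ℝ) ^ (1 - r) by
    linarith [Real.rpow_nonneg (Nat.cast_nonneg N : (0 : ℝ) ≤ N) (1 - r)]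
  induction N, hsN using Nat.le_induction with
  | base =>
    rw [Finset.sum_eq_zero fun k hk => if_pos (mem_range.mp hk)]
    simp
  | succ n hn ih =>
    rw [sum_range_succ, if_neg hn.not_gt, add_mul]
    have hstep := mul_rpow_neg_le_sub_rpow hr
      (show (0 : ℝ) < n from Nat.cast_pos.mpr (hs.trans_le hn))
    push_cast
    linarith

/-- The Schatten norm can be read off any unitary diagonalization of `Xᴴ * X`. -/
lemma schattenNorm_eq_of_diagonalization {N : ℕ} (q : ℝ) (X : Matrix (Fin N) (Fin N) ℝ)
    (U : unitaryGroup (Fin N) ℝ) (d : Fin N → ℝ)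
    (h : Xᴴ * X = (U : Matrix (Fin N) (Fin N) ℝ) * diagonal d *
      star (U : Matrix (Fin N) (Fin N) ℝ)) :
    schattenNorm q X = (∑ i, Real.sqrt (d i) ^ q) ^ (1 / q) := by
  have hchar : (Xᴴ * X).charpoly = (diagonal d).charpoly := by
    rw [h, charpoly_mul_comm, ← mul_assoc, Unitary.coe_star_mul_self, one_mul]
  have hroots : Multiset.map (isHermitian_conjTranspose_mul_self X).eigenvalues univ.val =
      Multiset.map d univ.val := by
    have hr := (isHermitian_conjTranspose_mul_self X).roots_charpoly_eq_eigenvalues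
    rw [hchar, charpoly_diagonal, Polynomial.roots_prod _ _
      (by simp [Finset.prod_ne_zero_iff, Polynomial.X_sub_C_ne_zero])] at hr
    simpa [Function.comp_def] using hr.symm
  have hsum := congrArg (fun m => (m.map fun x => Real.sqrt x ^ q).sum) hroots
  simp only [Multiset.map_map] at hsum
  exact congrArg (· ^ (1 / q)) hsum

lemma schattenNorm_nonneg {N : ℕ} (q : ℝ) (X : Matrix (Fin N) (Fin N) ℝ) :
    0 ≤ schattenNorm q X :=
  Real.rpow_nonneg (sum_nonneg fun _ _ => Real.rpow_nonneg (Real.sqrt_nonneg _) _) _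

lemma rhoS_le_schattenNorm_sub {N : ℕ} (q : ℝ) {s : ℕ} (X : Matrix (Fin N) (Fin N) ℝ)
    {Y : Matrix (Fin N) (Fin N) ℝ} (hY : Y.rank ≤ s) :
    rhoS q s X ≤ schattenNorm q (X - Y) := by
  refine csInf_le ⟨0, ?_⟩ ⟨Y, hY, rfl⟩
  rintro _ ⟨Z, -, rfl⟩
  exact schattenNorm_nonneg _ _

/-- Deleting the singular values indexed by a set of at most `s` indices
bounds the best rank-`s` approximation error. -/
lemma rhoS_le_of_card_le {N : ℕ} {q : ℝ} (hq : 0 < q) {s : ℕ} (X : Matrix (Fin N) (Fin N) ℝ)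
    (S : Finset (Fin N)) (hS : S.card ≤ s) :
    rhoS q s X ≤ (∑ i, if i ∈ S then 0 else singVals X i ^ q) ^ (1 / q) := by
  set hA := isHermitian_conjTranspose_mul_self X
  set U := hA.eigenvectorUnitary
  set V : Matrix (Fin N) (Fin N) ℝ := U.1
  have hVV : star V * V = 1 := Unitary.coe_star_mul_self U
  have hVV' : V * star V = 1 := Unitary.coe_mul_star_self U
  have hspec : Xᴴ * X = V * diagonal hA.eigenvalues * star V := by
    have h := hA.spectral_theorem
    rwa [Unitary.conjStarAlgAut_apply] at h
  set c : Fin N → ℝ := fun i => if i ∈ S then 1 else 0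
  have hrank : (X * (V * diagonal c * star V)).rank ≤ s := by
    refine (rank_mul_le_right _ _).trans ((rank_mul_le_left _ _).trans
      ((rank_mul_le_right _ _).trans ?_))
    rw [rank_diagonal]
    refine le_trans (le_of_eq ?_) hS
    rw [Fintype.card_subtype]
    congr 1
    ext i
    simp [c]
  have hsub : X - X * (V * diagonal c * star V) =
      X * (V * diagonal (fun i => 1 - c i) * star V) := by
    rw [show diagonal (fun i => 1 - c i) = 1 - diagonal c by
      rw [← diagonal_one, diagonal_sub], mul_sub, sub_mul, mul_one, hVV', mul_sub, mul_one]
  have hdiag : (X - X * (V * diagonal c * star V))ᴴ * (X - X * (V * diagonal c * star V)) =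
      V * diagonal (fun i => if i ∈ S then 0 else hA.eigenvalues i) * star V := by
    have hself : (V * diagonal (fun i => 1 - c i) * star V)ᴴ =
        V * diagonal (fun i => 1 - c i) * star V := by
      simp only [conjTranspose_mul, star_eq_conjTranspose, conjTranspose_conjTranspose,
        diagonal_conjTranspose, mul_assoc]
      congr 1
    rw [hsub, conjTranspose_mul, hself]
    calc V * diagonal (fun i => 1 - c i) * star V * Xᴴ *
          (X * (V * diagonal (fun i => 1 - c i) * star V))
        = V * diagonal (fun i => 1 - c i) * star V * (Xᴴ * X) *
          (V * diagonal (fun i => 1 - c i) * star V) := by simp only [mul_assoc]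
      _ = V * diagonal (fun i => 1 - c i) * (star V * V) * diagonal hA.eigenvalues *
          (star V * V) * diagonal (fun i => 1 - c i) * star V := by
        conv_lhs => rw [hspec]
        simp only [mul_assoc]
      _ = _ := by
        rw [hVV, mul_one, mul_one, mul_assoc V, mul_assoc V, diagonal_mul_diagonal,
          diagonal_mul_diagonal]
        congr 3
        ext i
        by_cases hi : i ∈ S <;> simp [c, hi]
  refine (rhoS_le_schattenNorm_sub q X hrank).trans (le_of_eq ?_)
  rw [schattenNorm_eq_of_diagonalization q _ U _ hdiag]
  congr 1
  refine sum_congr rfl fun i _ => ?_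
  by_cases hi : i ∈ S
  · simp [hi, Real.zero_rpow hq.ne']
  · simp [hi, singVals]

lemma sortedSingVals_nonneg {N : ℕ} (X : Matrix (Fin N) (Fin N) ℝ) (k : Fin N) :
    0 ≤ sortedSingVals X k :=
  Real.sqrt_nonneg _

lemma weakSchattenNorm_nonneg {N : ℕ} (p : ℝ) (X : Matrix (Fin N) (Fin N) ℝ) :
    0 ≤ weakSchattenNorm p X :=
  Real.iSup_nonneg fun k => mul_nonneg (by positivity) (sortedSingVals_nonneg X k)

lemma sortedSingVals_le {N : ℕ} (p : ℝ) (X : Matrix (Fin N) (Fin N) ℝ) (k : Fin N) :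
    sortedSingVals X k ≤ ((k : ℝ) + 1) ^ (-(1 / p)) * weakSchattenNorm p X := by
  have hle : ((k : ℝ) + 1) ^ (1 / p) * sortedSingVals X k ≤ weakSchattenNorm p X :=
    le_ciSup (f := fun k : Fin N => ((k : ℝ) + 1) ^ (1 / p) * sortedSingVals X k)
      (Set.finite_range _).bddAbove k
  rwa [Real.rpow_neg (by positivity), inv_mul_eq_div, le_div_iff₀' (by positivity)]

/-- The best rank-`s` error is at most the `ℓ_q` norm of the tail of the singular values. -/
lemma rhoS_le_tail {N : ℕ} {q : ℝ} (hq : 0 < q) (s : ℕ) (X : Matrix (Fin N) (Fin N) ℝ) :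
    rhoS q s X ≤
      (∑ k : Fin N, if (k : ℕ) < s then 0 else sortedSingVals X k ^ q) ^ (1 / q) := by
  set e : Fin N ≃ Fin N := Fin.revPerm.trans (Tuple.sort (singVals X))
  set T : Finset (Fin N) := {k | (k : ℕ) < s} with hT
  have hTcard : T.card ≤ s := by
    have h := card_le_card_of_injOn (s := T) (t := range s) (fun k : Fin N => (k : ℕ))
      (by intro k hk; simpa [hT] using hk) (Fin.val_injective.injOn)
    simpa using h
  refine (rhoS_le_of_card_le hq X (T.map e.toEmbedding) (by rwa [card_map])).trans (le_of_eq ?_)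
  congr 1
  rw [← e.sum_comp]
  refine sum_congr rfl fun k _ => ?_
  have hmem : e k ∈ T.map e.toEmbedding ↔ (k : ℕ) < s := by simp [hT]
  simp only [hmem]
  rfl

/-- Best rank-`s` approximation in `S_q` is controlled by
`D_{p,q} s^{-(1/p - 1/q)} ‖X‖_{S_{p,∞}}` for `p < q < ∞`, with `D_{p,q} = (q/p - 1)^{-1/q}`. -/
theorem best_rank_approx_weak_schatten (p q : ℝ) (hp0 : 0 < p) (hpq : p < q)
    (N : ℕ) (hN : 0 < N) (X : Matrix (Fin N) (Fin N) ℝ)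
    (s : ℕ) (hs : 0 < s) (hsN : s ≤ N) :
    rhoS q s X ≤
      (q / p - 1) ^ (-(1 / q)) * (s : ℝ) ^ (-(1 / p - 1 / q)) * weakSchattenNorm p X := by
  have hq : 0 < q := hp0.trans hpq
  have hr : 1 < q / p := (one_lt_div hp0).mpr hpq
  set W := weakSchattenNorm p X
  have hW : 0 ≤ W := weakSchattenNorm_nonneg p X
  have hs0 : (0 : ℝ) ≤ s := Nat.cast_nonneg s
  have htail : (∑ k : Fin N, if (k : ℕ) < s then 0 else sortedSingVals X k ^ q) ≤
      (s : ℝ) ^ (1 - q / p) / (q / p - 1) * W ^ q := by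
    refine le_trans ?_ (mul_le_mul_of_nonneg_right (sum_tail_rpow_neg_le hr hs hsN)
      (Real.rpow_nonneg hW q))
    rw [sum_mul]
    refine sum_le_sum fun k _ => ?_
    split_ifs
    · simp
    · refine (Real.rpow_le_rpow (sortedSingVals_nonneg X k) (sortedSingVals_le p X k)
        hq.le).trans (le_of_eq ?_)
      rw [Real.mul_rpow (by positivity) hW, ← Real.rpow_mul (by positivity)]
      congr 2
      ring
  have hnonneg : 0 ≤ ∑ k : Fin N, if (k : ℕ) < s then 0 else sortedSingVals X k ^ q := by
    refine sum_nonneg fun k _ => ?_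
    split_ifs
    exacts [le_rfl, Real.rpow_nonneg (sortedSingVals_nonneg X k) q]
  refine (rhoS_le_tail hq s X).trans
    ((Real.rpow_le_rpow hnonneg htail (by positivity)).trans (le_of_eq ?_))
  have hr0 : 0 ≤ q / p - 1 := by linarith
  rw [Real.mul_rpow (div_nonneg (Real.rpow_nonneg hs0 _) hr0) (Real.rpow_nonneg hW q),
    Real.div_rpow (Real.rpow_nonneg hs0 _) hr0, ← Real.rpow_mul hs0, ← Real.rpow_mul hW,
    mul_one_div_cancel hq.ne', Real.rpow_one, Real.rpow_neg hr0, div_eq_inv_mul]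
  congr 3
  field_simp
  ring
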